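/- Let n ≥ 1 and let a_1, …, a_n be integers with a_1 + ⋯ + a_n = 0. Assume the positive entries occur cyclically consecutively: there exist integers s and p such that for every index j ∈ {1, …, n}, a_j > 0 if and only if j ≡ s + k (mod n) for some 0 ≤ k < p. For 0 ≤ m ≤ n let S_m = a_1 + ⋯ + a_m (with S_0 = 0). Then (max_{0 ≤ m ≤ n} S_m) − (min_{0 ≤ m ≤ n} S_m) = Σ_{j : a_j > 0} a_j. -/

import Mathlib

theorem Finset.sum_le_sum_filter_pos {ι : Type*} {T U : Finset ι} (a : ι → ℤ) (h : T ⊆ U) :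
    ∑ i ∈ T, a i ≤ ∑ i ∈ U.filter fun i => 0 < a i, a i := by
  rw [Finset.sum_filter]
  calc ∑ i ∈ T, a i ≤ ∑ i ∈ T, (if 0 < a i then a i else 0) :=
        Finset.sum_le_sum fun i _ => by split_ifs <;> lia
    _ ≤ _ := Finset.sum_le_sum_of_subset_of_nonneg h fun i _ _ => by split_ifs <;> lia

/-- Partial sums of a sequence with total sum zero differ by at most the sum of the positive
entries. -/
theorem partial_sum_sub_le_sum_pos {n : ℕ} {a : ℕ → ℤ} (hsum : ∑ i ∈ Finset.range n, a i = 0)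
    {l m : ℕ} (hl : l ≤ n) (hm : m ≤ n) :
    ∑ i ∈ Finset.range m, a i - ∑ i ∈ Finset.range l, a i ≤
      ∑ j ∈ (Finset.range n).filter fun j => 0 < a j, a j := by
  rcases le_total l m with h | h
  · rw [← Finset.sum_Ico_eq_sub a h]
    exact Finset.sum_le_sum_filter_pos a fun i hi => by
      simp only [Finset.mem_Ico, Finset.mem_range] at hi ⊢; lia
  · have hsub : Finset.Ico m l ⊆ Finset.range n := fun i hi => by
      simp only [Finset.mem_Ico, Finset.mem_range] at hi ⊢; lia
    have h₁ := Finset.sum_sdiff (f := a) hsub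
    have h₂ := Finset.sum_Ico_eq_sub a h
    have h₃ := Finset.sum_le_sum_filter_pos a
      (Finset.sdiff_subset : Finset.range n \ Finset.Ico m l ⊆ Finset.range n)
    linarith

/-- A cyclic interval in `{0, …, n - 1}` is an interval or the complement of one. -/
theorem cyclic_interval_eq_Ico_or_compl {n : ℕ} (hn : 1 ≤ n) (s p : ℕ) :
    ∃ u v : ℕ, u ≤ v ∧ v ≤ n ∧
      ((∀ j < n, (∃ k < p, j % n = (s + k) % n) ↔ u ≤ j ∧ j < v) ∨
        ∀ j < n, (∃ k < p, j % n = (s + k) % n) ↔ ¬(u ≤ j ∧ j < v)) := by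
  have hs : s % n < n := Nat.mod_lt _ hn
  have key : ∀ j < n, (∃ k < p, j % n = (s + k) % n) ↔
      (s % n ≤ j ∧ j < s % n + p) ∨ j + n < s % n + p := by
    intro j hj
    rw [Nat.mod_eq_of_lt hj]
    constructor
    · rintro ⟨k, hk, h⟩
      rw [← Nat.mod_add_mod] at h
      have h' := Nat.mod_add_div (s % n + k) n
      rcases Nat.eq_zero_or_pos ((s % n + k) / n) with h0 | h0
      · rw [h0] at h'; lia
      · have := Nat.le_mul_of_pos_right n h0
        lia
    · rintro (⟨h₁, h₂⟩ | h)
      · refine ⟨j - s % n, by lia, ?_⟩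
        rw [← Nat.mod_add_mod, Nat.add_sub_cancel' h₁, Nat.mod_eq_of_lt hj]
      · refine ⟨j + n - s % n, by lia, ?_⟩
        rw [← Nat.mod_add_mod, Nat.add_sub_cancel' (by lia), Nat.add_mod_right,
          Nat.mod_eq_of_lt hj]
  rcases le_total n p with hp | hp
  · exact ⟨0, n, by lia, le_rfl, .inl fun j hj => by rw [key j hj]; lia⟩
  rcases le_total (s % n + p) n with h | h
  · exact ⟨s % n, s % n + p, by lia, h, .inl fun j hj => by rw [key j hj]; lia⟩
  · exact ⟨s % n + p - n, s % n, by lia, by lia, .inr fun j hj => by rw [key j hj]; lia⟩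

/-- If the positive entries of a sequence with total sum zero are cyclically consecutive, then
their sum is a difference of two partial sums. -/
theorem exists_partial_sum_sub_eq_sum_pos {n : ℕ} (hn : 1 ≤ n) {a : ℕ → ℤ}
    (hsum : ∑ i ∈ Finset.range n, a i = 0)
    (hcyc : ∃ s p : ℕ, ∀ j ∈ Finset.range n,
      (0 < a j ↔ ∃ k < p, j % n = (s + k) % n)) :
    ∃ l ≤ n, ∃ m ≤ n, ∑ i ∈ Finset.range m, a i - ∑ i ∈ Finset.range l, a i =
      ∑ j ∈ (Finset.range n).filter fun j => 0 < a j, a j := by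
  obtain ⟨s, p, hcyc⟩ := hcyc
  obtain ⟨u, v, huv, hv, h | h⟩ := cyclic_interval_eq_Ico_or_compl hn s p
  · refine ⟨u, huv.trans hv, v, hv, ?_⟩
    rw [← Finset.sum_Ico_eq_sub a huv]
    congr 1
    ext j
    simp only [Finset.mem_Ico, Finset.mem_filter, Finset.mem_range]
    grind
  · refine ⟨v, hv, u, huv.trans hv, ?_⟩
    have hsub : Finset.Ico u v ⊆ Finset.range n := fun i hi => by
      simp only [Finset.mem_Ico, Finset.mem_range] at hi ⊢; lia
    have h₁ := Finset.sum_sdiff (f := a) hsub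
    have h₂ := Finset.sum_Ico_eq_sub a huv
    have h₃ : (Finset.range n).filter (fun j => 0 < a j) =
        Finset.range n \ Finset.Ico u v := by
      ext j
      simp only [Finset.mem_Ico, Finset.mem_filter, Finset.mem_range, Finset.mem_sdiff]
      grind
    rw [h₃]
    linarith


/-- Let `n ≥ 1` and let `a_1, …, a_n` be integers (indexed here by `0, …, n−1`) with
`a_1 + ⋯ + a_n = 0`.  Assume the positive entries occur cyclically consecutively:
there exist `s` and `p` such that for every index `j`, `a_j > 0` iff
`j ≡ s + k (mod n)` for some `0 ≤ k < p`.  For `0 ≤ m ≤ n` let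
`S_m = a_1 + ⋯ + a_m` (with `S_0 = 0`).  Then
`(max_{0 ≤ m ≤ n} S_m) − (min_{0 ≤ m ≤ n} S_m) = Σ_{j : a_j > 0} a_j`. -/
theorem partial_sum_width_eq_sum_pos (n : ℕ) (hn : 1 ≤ n) (a : ℕ → ℤ)
    (hsum : ∑ i ∈ Finset.range n, a i = 0)
    (hcyc : ∃ s p : ℕ, ∀ j ∈ Finset.range n,
      (0 < a j ↔ ∃ k < p, j % n = (s + k) % n)) :
    ((Finset.range (n + 1)).sup' (Finset.nonempty_range_iff.mpr (Nat.succ_ne_zero n))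
        fun m => ∑ i ∈ Finset.range m, a i) -
      ((Finset.range (n + 1)).inf' (Finset.nonempty_range_iff.mpr (Nat.succ_ne_zero n))
        fun m => ∑ i ∈ Finset.range m, a i) =
    ∑ j ∈ (Finset.range n).filter fun j => 0 < a j, a j := by
  set S : ℕ → ℤ := fun m => ∑ i ∈ Finset.range m, a i
  apply le_antisymm
  · obtain ⟨m, hm, hm'⟩ := Finset.exists_mem_eq_sup'
      (Finset.nonempty_range_iff.mpr (Nat.succ_ne_zero n)) S
    obtain ⟨l, hl, hl'⟩ := Finset.exists_mem_eq_inf'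
      (Finset.nonempty_range_iff.mpr (Nat.succ_ne_zero n)) S
    rw [hm', hl']
    exact partial_sum_sub_le_sum_pos hsum (Finset.mem_range_succ_iff.mp hl)
      (Finset.mem_range_succ_iff.mp hm)
  · obtain ⟨l, hl, m, hm, h⟩ := exists_partial_sum_sub_eq_sum_pos hn hsum hcyc
    rw [← h]
    exact sub_le_sub (Finset.le_sup' S (Finset.mem_range_succ_iff.mpr hm))
      (Finset.inf'_le S (Finset.mem_range_succ_iff.mpr hl))
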